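/- There is no infinite definable discrete subset of M^k, for any k. -/

import Mathlib

/-! Common framework: dp-minimal structures with a definable uniform structure,
following "Dp-minimal structures equipped with definable uniformities". -/

namespace DpTame

open FirstOrder Set Cardinal

universe u

variable (L : FirstOrder.Language.{u, u}) (M : Type u) [L.Structure M]

/-- `A ⊆ M^α` is definable with parameters from `C ⊆ M`. -/
def DefSetP (C : Set M) {α : Type} (A : Set (α → M)) : Prop :=
  C.Definable L A

/-- `A ⊆ M^α` is definable (with parameters from `M`). -/
def DefSet {α : Type} (A : Set (α → M)) : Prop :=
  (Set.univ : Set M).Definable L A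

/-- A subset of `M` is definable (with parameters). -/
def DefSet1 (A : Set M) : Prop :=
  DefSet L M {v : Fin 1 → M | v 0 ∈ A}

/-- A definable relation between two tuple sorts, with parameters from `C`. -/
def DefRelP (C : Set M) {k l : ℕ} (G : Set ((Fin k → M) × (Fin l → M))) : Prop :=
  DefSetP L M C {v : (Fin k ⊕ Fin l) → M | (v ∘ Sum.inl, v ∘ Sum.inr) ∈ G}

/-- A definable relation between two tuple sorts, with parameters from `M`. -/
def DefRel {k l : ℕ} (G : Set ((Fin k → M) × (Fin l → M))) : Prop :=
  DefRelP L M Set.univ G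

/-- A definable subset of `M × M`. -/
def DefRel1 (G : Set (M × M)) : Prop :=
  DefSet L M {v : Fin 2 → M | (v 0, v 1) ∈ G}

/-- Model-theoretic algebraic closure of a parameter set `C ⊆ M`:
`a` lies in a finite `C`-definable set. -/
def aclOf (C : Set M) : Set M :=
  {a | ∃ S : Set (Fin 1 → M), C.Definable L S ∧ S.Finite ∧ (fun _ => a) ∈ S}

/-- The acl-dimension of a tuple over `C`: the minimal size of a subtuple over which (together
with `C`) the whole tuple is algebraic. -/
noncomputable def aclDimTuple (C : Set M) {k : ℕ} (a : Fin k → M) : ℕ :=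
  sInf {l | ∃ s : Finset (Fin k), s.card = l ∧ ∀ i, a i ∈ aclOf L M (C ∪ (a '' ↑s))}

open Classical in
/-- The acl-dimension of a set `A ⊆ M^k` defined over `C` (with `⊥` for the empty set). -/
noncomputable def aclDim (C : Set M) {k : ℕ} (A : Set (Fin k → M)) : WithBot ℕ :=
  if A = ∅ then ⊥ else ↑(sSup {l | ∃ a ∈ A, aclDimTuple L M C a = l})

/-- `A ⊆ M^k` has dp-rank greater than `n`: there are (definable-with-parameters) formulas
`φ_i(x,y)` for `i ≤ n` (coded as definable subsets of `M^k × M`) and infinite sets `B i ⊆ M`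
such that every choice from `∏ B i` is coded by an element of `A`. -/
def DpRankGt {k : ℕ} (A : Set (Fin k → M)) (n : ℕ) : Prop :=
  ∃ (Φ : Fin (n + 1) → Set ((Fin k ⊕ Fin 1) → M)) (B : Fin (n + 1) → Set M),
    (∀ i, DefSet L M (Φ i)) ∧ (∀ i, (B i).Infinite) ∧
    ∀ b : Fin (n + 1) → M, (∀ i, b i ∈ B i) →
      ∃ a ∈ A, ∀ i, ∀ y ∈ B i, (Sum.elim a (fun _ => y) ∈ Φ i ↔ y = b i)

open Classical in
/-- The dp-rank of a definable set, with `⊥` for the empty set. -/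
noncomputable def dpRank {k : ℕ} (A : Set (Fin k → M)) : WithBot ℕ :=
  if A = ∅ then ⊥ else ↑(sSup {m : ℕ | ∃ n, m = n + 1 ∧ DpRankGt L M A n})

/-- Dp-minimality (with respect to the home sort `M`): `M` does not have dp-rank greater
than one. -/
def DpMinimal : Prop :=
  ¬ DpRankGt L M (Set.univ : Set (Fin 1 → M)) 1

/-- `M` is NIP: no definable relation has the independence property. -/
def IsNIP : Prop :=
  ∀ (n m : ℕ) (Φ : Set ((Fin n ⊕ Fin m) → M)), DefSet L M Φ →
    ¬ ∃ (a : ℕ → Fin n → M) (b : Finset ℕ → Fin m → M),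
        ∀ (i : ℕ) (s : Finset ℕ), (Sum.elim (a i) (b s) ∈ Φ ↔ i ∈ s)

/-- Every finitely satisfiable collection of formulas in one variable over `C` is realized. -/
def RealizesTypesOver (C : Set M) : Prop :=
  ∀ p : Set ((L[[C]]).Formula (Fin 1)),
    (∀ s : Finset ((L[[C]]).Formula (Fin 1)), ↑s ⊆ p →
      ∃ a : M, ∀ φ ∈ s, φ.Realize (fun _ => a)) →
    ∃ a : M, ∀ φ ∈ p, φ.Realize (fun _ => a)

/-- `M` is `|L|⁺`-saturated. -/
def IsLPlusSaturated : Prop :=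
  ∀ C : Set M, #C ≤ L.card + ℵ₀ → RealizesTypesOver L M C

/-- Two tuples have the same type over `C`. -/
def SameTypeOver (C : Set M) {n : ℕ} (a b : Fin n → M) : Prop :=
  ∀ φ : (L[[C]]).Formula (Fin n), φ.Realize a ↔ φ.Realize b

/-- A sequence indexed by `ℕ` is indiscernible over `C`. -/
def IndiscernibleOver (C : Set M) (I : ℕ → M) : Prop :=
  ∀ (n : ℕ) (f g : Fin n → ℕ), StrictMono f → StrictMono g →
    SameTypeOver L M C (I ∘ f) (I ∘ g)

/-- The sequences `I l` are mutually indiscernible over `C`: each is indiscernible over `C`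
together with all of the other sequences. -/
def MutuallyIndiscernibleOver (C : Set M) {k : ℕ} (I : Fin k → ℕ → M) : Prop :=
  ∀ l : Fin k,
    IndiscernibleOver L M (C ∪ ⋃ m ∈ ({m : Fin k | m ≠ l} : Set (Fin k)), Set.range (I m)) (I l)

/-- A correspondence with domain `E ⊆ M^k`, values in `M^l`, definable over `C`: a definable
graph all of whose fibers over points of `E` are finite and nonempty. -/
def IsCorrP (C : Set M) {k l : ℕ} (E : Set (Fin k → M))
    (G : Set ((Fin k → M) × (Fin l → M))) : Prop :=
  DefRelP L M C G ∧ (∀ p ∈ G, p.1 ∈ E) ∧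
    ∀ x ∈ E, {y | (x, y) ∈ G}.Nonempty ∧ {y | (x, y) ∈ G}.Finite

/-- A correspondence, definable with arbitrary parameters. -/
def IsCorr {k l : ℕ} (E : Set (Fin k → M)) (G : Set ((Fin k → M) × (Fin l → M))) : Prop :=
  IsCorrP L M Set.univ E G

/-- An `m`-correspondence: every fiber has exactly `m` elements. -/
def IsMCorrP (C : Set M) {k l : ℕ} (E : Set (Fin k → M))
    (G : Set ((Fin k → M) × (Fin l → M))) (m : ℕ) : Prop :=
  IsCorrP L M C E G ∧ ∀ x ∈ E, {y | (x, y) ∈ G}.ncard = m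

/-- An `m`-correspondence definable with arbitrary parameters. -/
def IsMCorr {k l : ℕ} (E : Set (Fin k → M)) (G : Set ((Fin k → M) × (Fin l → M)))
    (m : ℕ) : Prop :=
  IsMCorrP L M Set.univ E G m

/-- A definable uniform structure on `M`: a definable basis of entourages
`{φ(M², c̄) : c̄ ∈ dom}` satisfying the axioms for a basis of a (Hausdorff) uniformity. -/
structure DefUniformBasis where
  n : ℕ
  dom : Set (Fin n → M)
  dom_nonempty : dom.Nonempty
  dom_def : DefSet L M dom
  phi : Set ((Fin 2 ⊕ Fin n) → M)
  phi_def : DefSet L M phi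
  symm : ∀ c ∈ dom, ∀ x y : M, Sum.elim ![x, y] c ∈ phi → Sum.elim ![y, x] c ∈ phi
  inter_eq_diag : ∀ x y : M, (∀ c ∈ dom, Sum.elim ![x, y] c ∈ phi) ↔ x = y
  directed : ∀ c ∈ dom, ∀ d ∈ dom, ∃ e ∈ dom, ∀ x y : M,
    Sum.elim ![x, y] e ∈ phi → Sum.elim ![x, y] c ∈ phi ∧ Sum.elim ![x, y] d ∈ phi
  comp : ∀ c ∈ dom, ∃ d ∈ dom, ∀ x y z : M,
    Sum.elim ![x, y] d ∈ phi → Sum.elim ![y, z] d ∈ phi → Sum.elim ![x, z] c ∈ phi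

namespace DefUniformBasis

variable {L M} (U : DefUniformBasis L M)

/-- The entourage with parameter `c`. -/
def ent (c : Fin U.n → M) : Set (M × M) :=
  {p | Sum.elim ![p.1, p.2] c ∈ U.phi}

/-- The ball of radius `c` around `x ∈ M`. -/
def ball (c : Fin U.n → M) (x : M) : Set M :=
  {y | (x, y) ∈ U.ent c}

/-- The ball of radius `c` around `x ∈ M^k` (product uniformity). -/
def ballk {k : ℕ} (c : Fin U.n → M) (x : Fin k → M) : Set (Fin k → M) :=
  {y | ∀ i, (x i, y i) ∈ U.ent c}

/-- Openness in `M` for the topology induced by the uniform structure. -/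
def IsOpen1 (A : Set M) : Prop :=
  ∀ x ∈ A, ∃ c ∈ U.dom, U.ball c x ⊆ A

/-- Interior in `M`. -/
def interior1 (A : Set M) : Set M :=
  {x | ∃ c ∈ U.dom, U.ball c x ⊆ A}

/-- Closure in `M`. -/
def closure1 (A : Set M) : Set M :=
  {x | ∀ c ∈ U.dom, (U.ball c x ∩ A).Nonempty}

/-- Openness in `M^k` for the product topology. -/
def IsOpenk {k : ℕ} (A : Set (Fin k → M)) : Prop :=
  ∀ x ∈ A, ∃ c ∈ U.dom, U.ballk c x ⊆ A

/-- Interior in `M^k`. -/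
def interiork {k : ℕ} (A : Set (Fin k → M)) : Set (Fin k → M) :=
  {x | ∃ c ∈ U.dom, U.ballk c x ⊆ A}

/-- Closure in `M^k`. -/
def closurek {k : ℕ} (A : Set (Fin k → M)) : Set (Fin k → M) :=
  {x | ∀ c ∈ U.dom, (U.ballk c x ∩ A).Nonempty}

/-- The frontier `∂A = cl(A) ∖ A`. -/
def frontierk {k : ℕ} (A : Set (Fin k → M)) : Set (Fin k → M) :=
  U.closurek A \ A

/-- Closedness in `M^k`. -/
def IsClosedk {k : ℕ} (A : Set (Fin k → M)) : Prop :=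
  U.closurek A ⊆ A

/-- `B` is dense in `A`. -/
def DenseIn {k : ℕ} (B A : Set (Fin k → M)) : Prop :=
  A ⊆ U.closurek B

/-- `A ⊆ M^k` is locally closed: every point of `A` has a (ball) neighborhood `W` such that
`A ∩ W` is closed in `W`. -/
def IsLocallyClosedk {k : ℕ} (A : Set (Fin k → M)) : Prop :=
  ∀ x ∈ A, ∃ c ∈ U.dom, U.ballk c x ∩ U.closurek (A ∩ U.ballk c x) ⊆ A

open Classical in
/-- The naive topological dimension of `A ⊆ M^k`: the largest `l` such that some coordinate
projection of `A` to `M^l` has nonempty interior (`⊥` for the empty set). -/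
noncomputable def topDim {k : ℕ} (A : Set (Fin k → M)) : WithBot ℕ :=
  if A = ∅ then ⊥ else
    ↑(sSup {l : ℕ | ∃ σ : Fin l → Fin k, Function.Injective σ ∧
        (U.interiork ((fun v => v ∘ σ) '' A)).Nonempty})

/-- Continuity of a correspondence with domain `E` and graph `G` at a point `x ∈ E`. -/
def CorrContAt {k l : ℕ} (E : Set (Fin k → M)) (G : Set ((Fin k → M) × (Fin l → M)))
    (x : Fin k → M) : Prop :=
  ∀ c ∈ U.dom, ∃ d ∈ U.dom, ∀ x' ∈ E, x' ∈ U.ballk d x →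
    (∀ y, (x, y) ∈ G → ∃ y', (x', y') ∈ G ∧ ∀ j, (y j, y' j) ∈ U.ent c) ∧
    (∀ y', (x', y') ∈ G → ∃ y, (x, y) ∈ G ∧ ∀ j, (y j, y' j) ∈ U.ent c)

/-- Continuity of a correspondence at every point of its domain. -/
def CorrContOn {k l : ℕ} (E : Set (Fin k → M)) (G : Set ((Fin k → M) × (Fin l → M))) : Prop :=
  ∀ x ∈ E, U.CorrContAt E G x

/-- Continuity of a function `M^k → M^l` on a set `V` (relative topology). -/
def ContOn {k l : ℕ} (f : (Fin k → M) → (Fin l → M)) (V : Set (Fin k → M)) : Prop :=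
  ∀ x ∈ V, ∀ c ∈ U.dom, ∃ d ∈ U.dom, ∀ y ∈ V, y ∈ U.ballk d x → f y ∈ U.ballk c (f x)

/-- `f` restricted to `V` is a homeomorphism onto its image. -/
def HomeoOnto {k l : ℕ} (f : (Fin k → M) → (Fin l → M)) (V : Set (Fin k → M)) : Prop :=
  Set.InjOn f V ∧ U.ContOn f V ∧
    ∀ x ∈ V, ∀ c ∈ U.dom, ∃ d ∈ U.dom, ∀ y ∈ V, f y ∈ U.ballk d (f x) → y ∈ U.ballk c x

/-- Continuity of a function `M → M` on a set `V`. -/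
def Cont1On (f : M → M) (V : Set M) : Prop :=
  ∀ x ∈ V, ∀ c ∈ U.dom, ∃ d ∈ U.dom, ∀ y ∈ V, y ∈ U.ball d x → f y ∈ U.ball c (f x)

/-- `f : M → M` restricted to `V` is a homeomorphism onto its image. -/
def Homeo1Onto (f : M → M) (V : Set M) : Prop :=
  Set.InjOn f V ∧ U.Cont1On f V ∧
    ∀ x ∈ V, ∀ c ∈ U.dom, ∃ d ∈ U.dom, ∀ y ∈ V, f y ∈ U.ball d (f x) → y ∈ U.ball c x

end DefUniformBasis

/-- The standing assumptions of the paper: `M` is an infinite `|L|⁺`-saturated NIP dp-minimal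
structure carrying a definable uniform structure whose topology has no isolated points and in
which every infinite definable subset of `M` has nonempty interior (Inf). -/
structure Setting extends DefUniformBasis L M where
  nonempty : Nonempty M
  saturated : IsLPlusSaturated L M
  nip : IsNIP L M
  dpMin : DpMinimal L M
  noIsolated : ∀ x : M, ∀ c ∈ toDefUniformBasis.dom, ∃ y, y ≠ x ∧
    y ∈ toDefUniformBasis.ball c x
  infInterior : ∀ A : Set M, DefSet1 L M A → A.Infinite →
    (toDefUniformBasis.interior1 A).Nonempty

end DpTame

namespace DpTame

open FirstOrder Set Cardinal

universe u

variable {L : FirstOrder.Language.{u, u}} {M : Type u} [L.Structure M]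

section Definability

/-- Definability is preserved when coordinates are replaced by other coordinates or by fixed
elements of `M`. -/
theorem DefSet.preimage_subst {α β : Type} {A : Set (α → M)} (hA : DefSet L M A)
    (t : α → β ⊕ M) : DefSet L M {v : β → M | (fun i => Sum.elim v id (t i)) ∈ A} := by
  obtain ⟨φ, rfl⟩ := hA
  refine ⟨φ.subst (fun i => Sum.elim (fun b => Language.Term.var b)
    (fun a => (L.con (⟨a, mem_univ a⟩ : (univ : Set M))).term) (t i)), ?_⟩
  ext v
  have h : (fun i => Sum.elim v id (t i)) = fun i => (Sum.elim (fun b => Language.Term.var b)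
      (fun a => (L.con (⟨a, mem_univ a⟩ : (univ : Set M))).term) (t i) :
        L[[(univ : Set M)]].Term β).realize v := by
    funext i
    rcases t i with b | a
    · rfl
    · exact (Language.Term.realize_con (a := (⟨a, mem_univ a⟩ : (univ : Set M)))).symm
  change Language.Formula.Realize φ _ ↔ Language.BoundedFormula.Realize _ v default
  rw [Language.BoundedFormula.realize_subst, h]
  rfl

theorem defSet_coord_eq {α : Type} (i j : α) : DefSet L M {v : α → M | v i = v j} :=
  ⟨(Language.Term.var i).equal (Language.Term.var j), by ext; simp⟩

theorem DefSet.forall_fin {α : Type} {k : ℕ} {P : Fin k → (α → M) → Prop}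
    (h : ∀ i, DefSet L M {v | P i v}) : DefSet L M {v | ∀ i, P i v} := by
  have := definable_iInter_of_finite h
  unfold DefSet
  convert! this using 1
  ext; simp

/-- The slice of a definable set at a given first coordinate. -/
theorem DefSet.cons_slice {n : ℕ} {A : Set (Fin (n + 1) → M)} (hA : DefSet L M A) (a : M) :
    DefSet L M {v : Fin n → M | (Fin.cons a v : Fin (n + 1) → M) ∈ A} := by
  convert! hA.preimage_subst
    (Fin.cons (Sum.inr a) Sum.inl : Fin (n + 1) → Fin n ⊕ M) using 4 with v
  funext i
  refine Fin.cases ?_ (fun j => ?_) i <;> simp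

/-- The projection of a definable set to the first coordinate. -/
theorem DefSet.proj_head {n : ℕ} {A : Set (Fin (n + 1) → M)} (hA : DefSet L M A) :
    DefSet1 L M {a : M | ∃ v : Fin n → M, (Fin.cons a v : Fin (n + 1) → M) ∈ A} := by
  have h := Definable.exists_of_finite (hA.preimage_subst
    (Fin.cons (Sum.inl (Sum.inl 0)) (fun j => Sum.inl (Sum.inr j)) :
      Fin (n + 1) → (Fin 1 ⊕ Fin n) ⊕ M))
  unfold DefSet1 DefSet
  convert! h using 1
  ext v
  refine exists_congr fun w => iff_of_eq (congrArg (· ∈ A) ?_)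
  funext i
  refine Fin.cases ?_ (fun j => ?_) i <;> simp

/-- The projection to the last `n` coordinates of the part of a definable set lying over a
definable set of first coordinates. -/
theorem DefSet.proj_tail {n : ℕ} {A : Set (Fin (n + 1) → M)} (hA : DefSet L M A) {V : Set M}
    (hV : DefSet1 L M V) :
    DefSet L M {v : Fin n → M | ∃ x ∈ V, (Fin.cons x v : Fin (n + 1) → M) ∈ A} := by
  have h₁ := hA.preimage_subst
    (Fin.cons (Sum.inl (Sum.inr 0)) (fun j => Sum.inl (Sum.inl j)) :
      Fin (n + 1) → (Fin n ⊕ Fin 1) ⊕ M)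
  have h₂ := DefSet.preimage_subst hV
    ((fun _ => Sum.inl (Sum.inr 0)) : Fin 1 → (Fin n ⊕ Fin 1) ⊕ M)
  have h := Definable.exists_of_finite (h₂.inter h₁)
  unfold DefSet
  convert! h using 1
  have key : ∀ (v : Fin n → M) (u : Fin 1 → M),
      (fun i => Sum.elim (Sum.elim v u) id ((Fin.cons (Sum.inl (Sum.inr 0))
        (fun j => Sum.inl (Sum.inl j)) : Fin (n + 1) → (Fin n ⊕ Fin 1) ⊕ M) i)) =
      (Fin.cons (u 0) v : Fin (n + 1) → M) := by
    intro v u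
    funext i
    refine Fin.cases ?_ (fun j => ?_) i <;> simp
  ext v
  simp only [mem_ofPred_eq, mem_inter_iff, key, Sum.elim_inl, Sum.elim_inr]
  exact ⟨fun ⟨x, hx⟩ => ⟨fun _ => x, hx⟩, fun ⟨u, hu⟩ => ⟨u 0, hu⟩⟩

end Definability

section Saturation

/-- A decreasing sequence of nonempty definable subsets of `M` has nonempty intersection. -/
theorem IsLPlusSaturated.exists_mem_of_antitone (h : IsLPlusSaturated L M) (E : ℕ → Set M)
    (hE : ∀ i, DefSet1 L M (E i)) (hne : ∀ i, (E i).Nonempty) (hanti : Antitone E) :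
    ∃ a, ∀ i, a ∈ E i := by
  choose C _ hC using fun i => definable_iff_finitely_definable.1 (hE i)
  have hdef : ∀ i, (⋃ j, (C j : Set M)).Definable L {v : Fin 1 → M | v 0 ∈ E i} := fun i =>
    (hC i).mono (subset_iUnion (fun j => (C j : Set M)) i)
  choose φ hφ using hdef
  have hφ' : ∀ i a, (φ i).Realize (fun _ => a) ↔ a ∈ E i := fun i a =>
    (Set.ext_iff.1 (hφ i) (fun _ => a)).symm
  have hcard : #(⋃ j, (C j : Set M) : Set M) ≤ L.card + ℵ₀ :=
    (Cardinal.mk_le_aleph0_iff.2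
      (countable_iUnion fun j => (C j).countable_toSet).to_subtype).trans le_add_self
  obtain ⟨a, ha⟩ := h _ hcard (range φ) (by
    classical
    intro s hs
    obtain ⟨t, rfl⟩ : ∃ t : Finset ℕ, t.image φ = s := by
      obtain ⟨t, -, ht⟩ := Finset.subset_set_image_iff.1 (by rwa [← image_univ] at hs)
      exact ⟨t, ht⟩
    obtain ⟨a, ha⟩ := hne (t.sup id)
    refine ⟨a, fun ψ hψ => ?_⟩
    obtain ⟨i, hi, rfl⟩ := Finset.mem_image.1 hψ
    exact (hφ' i a).2 (hanti (Finset.le_sup (f := id) hi) ha))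
  exact ⟨a, fun i => (hφ' i a).1 (ha _ ⟨i, rfl⟩)⟩

/-- A decreasing sequence of nonempty definable subsets of `M^n` has nonempty intersection. -/
theorem IsLPlusSaturated.exists_tuple_mem_of_antitone (h : IsLPlusSaturated L M) {n : ℕ}
    (D : ℕ → Set (Fin n → M)) (hD : ∀ i, DefSet L M (D i)) (hne : ∀ i, (D i).Nonempty)
    (hanti : Antitone D) : ∃ v, ∀ i, v ∈ D i := by
  induction n with
  | zero => exact ⟨Fin.elim0, fun i => by
      obtain ⟨v, hv⟩ := hne i
      rwa [Subsingleton.elim Fin.elim0 v]⟩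
  | succ n ih =>
    obtain ⟨a, ha⟩ := h.exists_mem_of_antitone
      (fun i => {a : M | ∃ v : Fin n → M, (Fin.cons a v : Fin (n + 1) → M) ∈ D i})
      (fun i => (hD i).proj_head)
      (fun i => by
        obtain ⟨w, hw⟩ := hne i
        exact ⟨w 0, Fin.tail w, by rwa [Fin.cons_self_tail]⟩)
      (fun i j hij a ⟨v, hv⟩ => ⟨v, hanti hij hv⟩)
    obtain ⟨v, hv⟩ := ih
      (fun i => {v : Fin n → M | (Fin.cons a v : Fin (n + 1) → M) ∈ D i})
      (fun i => (hD i).cons_slice a) ha (fun i j hij v hv => hanti hij hv)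
    exact ⟨_, hv⟩

end Saturation

namespace DefUniformBasis

variable (U : DefUniformBasis L M)

/-- Distinct elements of `A` are never `c`-close. -/
def Separated (c : Fin U.n → M) {k : ℕ} (A : Set (Fin k → M)) : Prop :=
  ∀ p ∈ A, ∀ z ∈ A, z ∈ U.ballk c p → z = p

variable {U}

theorem mk_self_mem_ent {c : Fin U.n → M} (hc : c ∈ U.dom) (x : M) : (x, x) ∈ U.ent c :=
  (U.inter_eq_diag x x).2 rfl c hc

theorem exists_ent_subset_of_finset {ι : Type*} (s : Finset ι) (c : ι → Fin U.n → M)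
    (hc : ∀ i ∈ s, c i ∈ U.dom) : ∃ e ∈ U.dom, ∀ i ∈ s, U.ent e ⊆ U.ent (c i) := by
  classical
  induction s using Finset.induction_on with
  | empty =>
    obtain ⟨e, he⟩ := U.dom_nonempty
    exact ⟨e, he, by simp⟩
  | insert a s _ ih =>
    obtain ⟨e, he, hes⟩ := ih fun i hi => hc i (Finset.mem_insert_of_mem hi)
    obtain ⟨f, hf, hfe⟩ := U.directed e he (c a) (hc a (Finset.mem_insert_self a s))
    refine ⟨f, hf, fun i hi p hp => ?_⟩
    rcases Finset.mem_insert.1 hi with rfl | hi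
    · exact (hfe p.1 p.2 hp).2
    · exact hes i hi (hfe p.1 p.2 hp).1

theorem defSet1_ball (c : Fin U.n → M) (x : M) : DefSet1 L M (U.ball c x) := by
  have h := U.phi_def.preimage_subst
    (Sum.elim ![Sum.inr x, Sum.inl 0] (fun j => Sum.inr (c j)) :
      Fin 2 ⊕ Fin U.n → Fin 1 ⊕ M)
  unfold DefSet1 DefSet
  convert! h using 1
  ext v
  simp only [ball, ent, mem_ofPred_eq]
  refine iff_of_eq (congrArg (· ∈ U.phi) ?_)
  funext i
  rcases i with i | i
  · fin_cases i <;> rfl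
  · rfl

/-- The relation "`x` has a `c`-close point of `A` distinct from it" is definable
in `(x, c)`. -/
theorem defSet_exists_close {k : ℕ} {A : Set (Fin k → M)} (hA : DefSet L M A) :
    DefSet L M {v : Fin k ⊕ Fin U.n → M |
      ∃ z ∈ A, z ∈ U.ballk (v ∘ Sum.inr) (v ∘ Sum.inl) ∧ z ≠ v ∘ Sum.inl} := by
  have h₁ : DefSet L M {w : (Fin k ⊕ Fin U.n) ⊕ Fin k → M | w ∘ Sum.inr ∈ A} :=
    Definable.preimage_comp Sum.inr hA
  have h₂ : DefSet L M {w : (Fin k ⊕ Fin U.n) ⊕ Fin k → M |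
      ∀ i, (w (Sum.inl (Sum.inl i)), w (Sum.inr i)) ∈ U.ent (w ∘ Sum.inl ∘ Sum.inr)} := by
    refine DefSet.forall_fin fun i => ?_
    have h := Definable.preimage_comp
      (Sum.elim ![Sum.inl (Sum.inl i), Sum.inr i] (fun j => Sum.inl (Sum.inr j)) :
        Fin 2 ⊕ Fin U.n → (Fin k ⊕ Fin U.n) ⊕ Fin k) U.phi_def
    unfold DefSet
    convert! h using 1
    ext v
    simp only [ent, mem_ofPred_eq, mem_preimage]
    refine iff_of_eq (congrArg (· ∈ U.phi) ?_)
    funext i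
    rcases i with i | i
    · fin_cases i <;> rfl
    · rfl
  have h₃ : DefSet L M {w : (Fin k ⊕ Fin U.n) ⊕ Fin k → M |
      ∀ i, w (Sum.inr i) = w (Sum.inl (Sum.inl i))} :=
    DefSet.forall_fin fun i => defSet_coord_eq _ _
  have h := Definable.exists_of_finite (h₁.inter (h₂.inter h₃.compl))
  unfold DefSet
  convert! h using 1
  ext v
  exact exists_congr fun z => and_congr Iff.rfl (and_congr Iff.rfl (not_congr funext_iff))

theorem defSet_separated_at {k : ℕ} {A : Set (Fin k → M)} (hA : DefSet L M A)
    (p : Fin k → M) :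
    DefSet L M {c : Fin U.n → M | ∀ z ∈ A, z ∈ U.ballk c p → z = p} := by
  have h := ((defSet_exists_close (U := U) hA).preimage_subst
    (Sum.elim (fun i => Sum.inr (p i)) Sum.inl : Fin k ⊕ Fin U.n → Fin U.n ⊕ M)).compl
  unfold DefSet
  convert! h using 1
  ext c
  change _ ↔ ¬ ∃ z ∈ A, z ∈ U.ballk c p ∧ z ≠ p
  push Not
  rfl

theorem defSet_separated_points {k : ℕ} {A : Set (Fin k → M)} (hA : DefSet L M A)
    (c : Fin U.n → M) :
    DefSet L M {p | p ∈ A ∧ ∀ z ∈ A, z ∈ U.ballk c p → z = p} := by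
  have h := hA.inter ((defSet_exists_close (U := U) hA).preimage_subst
    (Sum.elim Sum.inl (fun i => Sum.inr (c i)) : Fin k ⊕ Fin U.n → Fin k ⊕ M)).compl
  unfold DefSet
  convert! h using 1
  ext p
  change _ ↔ p ∈ A ∧ ¬ ∃ z ∈ A, z ∈ U.ballk c p ∧ z ≠ p
  push Not
  rfl

end DefUniformBasis

namespace Setting

theorem infinite_ball (S : Setting L M) {c : Fin S.n → M} (hc : c ∈ S.dom) (x : M) :
    (S.ball c x).Infinite := by
  classical
  intro hfin
  have hsep : ∀ y, ∃ d ∈ S.dom, y ≠ x → (x, y) ∉ S.ent d := by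
    intro y
    by_cases hy : y = x
    · exact ⟨c, hc, fun h => absurd hy h⟩
    · have := mt (S.inter_eq_diag x y).1 (Ne.symm hy)
      push Not at this
      obtain ⟨d, hd, hxy⟩ := this
      exact ⟨d, hd, fun _ => hxy⟩
  choose d hd hdx using hsep
  obtain ⟨e, he, hes⟩ := DefUniformBasis.exists_ent_subset_of_finset hfin.toFinset d
    fun i _ => hd i
  obtain ⟨f, hf, hfe⟩ := S.directed c hc e he
  obtain ⟨y, hyx, hy⟩ := S.noIsolated x f hf
  exact hdx y hyx (hes y (hfin.mem_toFinset.2 (hfe x y hy).1) (hfe x y hy).2)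

/-- A definable set whose points are uniformly separated is finite. -/
theorem finite_of_separated (S : Setting L M) {c : Fin S.n → M} (hc : c ∈ S.dom) {k : ℕ}
    {A : Set (Fin k → M)} (hA : DefSet L M A) (hsep : S.Separated c A) : A.Finite := by
  induction k with
  | zero => exact A.toFinite
  | succ k ih =>
    have hfib : ∀ x, {v : Fin k → M | (Fin.cons x v : Fin (k + 1) → M) ∈ A}.Finite := by
      refine fun x => ih (hA.cons_slice x) fun p hp z hz hzp => ?_
      refine Fin.cons_right_injective (α := fun _ => M) x (hsep _ hp _ hz fun i => ?_)
      refine Fin.cases ?_ (fun j => ?_) i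
      · exact DefUniformBasis.mk_self_mem_ent hc x
      · simpa using hzp j
    by_contra hinf
    let P : Set M := {x | ∃ v : Fin k → M, (Fin.cons x v : Fin (k + 1) → M) ∈ A}
    have hPinf : P.Infinite := by
      refine fun hPfin => hinf ((hPfin.biUnion fun x _ =>
        (hfib x).image (fun v => (Fin.cons x v : Fin (k + 1) → M))).subset fun w hw => ?_)
      have hw' : (Fin.cons (w 0) (Fin.tail w) : Fin (k + 1) → M) ∈ A := by
        rwa [Fin.cons_self_tail]
      exact mem_biUnion (x := w 0) ⟨_, hw'⟩ ⟨_, hw', Fin.cons_self_tail w⟩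
    obtain ⟨x₀, c₁, hc₁, hball⟩ := S.infInterior P hA.proj_head hPinf
    obtain ⟨d, hd, hdc⟩ := S.comp c hc
    obtain ⟨e, he, hed⟩ := S.directed c₁ hc₁ d hd
    have hclose : ∀ x ∈ S.ball e x₀, ∀ y ∈ S.ball e x₀, (x, y) ∈ S.ent c := fun x hx y hy =>
      hdc x x₀ y (S.symm d hd _ _ (hed _ _ hx).2) (hed _ _ hy).2
    have hCfin := ih (hA.proj_tail (DefUniformBasis.defSet1_ball e x₀)) (by
      rintro p ⟨x, hx, hxp⟩ z ⟨y, hy, hyz⟩ hzp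
      refine (Fin.cons_inj.1 (hsep _ hxp _ hyz fun i => ?_)).2
      refine Fin.cases ?_ (fun j => ?_) i
      · exact hclose x hx y hy
      · simpa using hzp j)
    choose! f hf using fun x (hx : x ∈ S.ball e x₀) => hball (hed _ _ hx).1
    have hmaps : MapsTo f (S.ball e x₀)
        {v | ∃ x ∈ S.ball e x₀, (Fin.cons x v : Fin (k + 1) → M) ∈ A} :=
      fun x hx => ⟨x, hx, hf x hx⟩
    obtain ⟨x, hx, y, hy, hne, hxy⟩ :=
      (S.infinite_ball he x₀).exists_ne_map_eq_of_mapsTo hmaps hCfin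
    refine hne (congrFun (hsep _ (hf y hy) _ (hf x hx) fun i => ?_) 0)
    refine Fin.cases ?_ (fun j => ?_) i
    · exact hclose y hy x hx
    · simpa only [Fin.cons_succ, hxy] using DefUniformBasis.mk_self_mem_ent hc (f y j)

end Setting

/-- There is no infinite definable discrete subset of `M^k` (discrete: the set
has no accumulation points). -/
theorem statement19 (S : Setting L M) {k : ℕ} (A : Set (Fin k → M)) (hA : DefSet L M A)
    (hdisc : ∀ p : Fin k → M, ∃ c ∈ S.toDefUniformBasis.dom,
      ∀ y ∈ A, y ∈ S.toDefUniformBasis.ballk c p → y = p) :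
    A.Finite := by
  by_contra hinf
  have hinf : A.Infinite := hinf
  let p := hinf.natEmbedding
  obtain ⟨c, hc⟩ := S.saturated.exists_tuple_mem_of_antitone
    (fun i => S.dom ∩ ⋂ j ∈ Finset.range (i + 1),
      {c : Fin S.n → M | ∀ z ∈ A, z ∈ S.ballk c (p j) → z = p j})
    (fun i => S.dom_def.inter (definable_biInter_finset
      (fun j => DefUniformBasis.defSet_separated_at hA (p j).1) _))
    (fun i => by
      choose c hc hcp using fun j => hdisc (p j).1
      obtain ⟨e, he, hec⟩ := DefUniformBasis.exists_ent_subset_of_finset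
        (Finset.range (i + 1)) c fun j _ => hc j
      exact ⟨e, he, mem_iInter₂.2 fun j hj z hz hze => hcp j z hz fun l => hec j hj (hze l)⟩)
    (fun i j hij => inter_subset_inter_right _ (biInter_subset_biInter_left fun l hl => by
      simp only [Finset.mem_coe, Finset.mem_range] at hl ⊢
      omega))
  refine (infinite_range_of_injective (Subtype.val_injective.comp p.injective)).mono ?_
    (S.finite_of_separated (hc 0).1 (DefUniformBasis.defSet_separated_points hA c)
      fun q hq z hz hzq => hq.2 z hz.1 hzq)
  rintro _ ⟨j, rfl⟩
  exact ⟨(p j).2, mem_iInter₂.1 (hc j).2 j (Finset.self_mem_range_succ j)⟩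

end DpTame
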